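/- arXiv:1904.00901 — 2 statements merged into one kernel-verified Lean document; each statement's English description precedes it below -/
import Mathlib

section
/- Let W: ℝ² → ℝ be C³ with W_v = W_{uu} everywhere, and let u, v: ℝ² → ℝ be differentiable functions of (t,x) such that for all (t,x) one has W_v(u(t,x), v(t,x)) = t and W_u(u(t,x), v(t,x)) − u(t,x) · W_v(u(t,x), v(t,x)) = x. If W_{uuu}(u(t₀,x₀), v(t₀,x₀)) ≠ 0 at a point (t₀,x₀), then at that point u and v satisfy the Jordan system: u_t = u u_x + v_x and v_t = u v_x. -/
/-- Partial derivative in the first variable. -/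
noncomputable def pu (f : ℝ × ℝ → ℝ) (p : ℝ × ℝ) : ℝ := fderiv ℝ f p (1, 0)

/-- Partial derivative in the second variable. -/
noncomputable def pv (f : ℝ × ℝ → ℝ) (p : ℝ × ℝ) : ℝ := fderiv ℝ f p (0, 1)

lemma fderiv_apply_eq_pu_add_pv (g : ℝ × ℝ → ℝ) (p : ℝ × ℝ) (a b : ℝ) :
    fderiv ℝ g p (a, b) = pu g p * a + pv g p * b := by
  have h : ((a, b) : ℝ × ℝ) = a • ((1, 0) : ℝ × ℝ) + b • ((0, 1) : ℝ × ℝ) := by simp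
  rw [h, map_add, map_smul, map_smul]
  simp only [pu, pv, smul_eq_mul]
  ring

lemma fderiv_comp_prodMk_apply {g u v : ℝ × ℝ → ℝ} (hg : Differentiable ℝ g)
    (hu : Differentiable ℝ u) (hv : Differentiable ℝ v) (q e : ℝ × ℝ) :
    fderiv ℝ (fun q => g (u q, v q)) q e =
      pu g (u q, v q) * fderiv ℝ u q e + pv g (u q, v q) * fderiv ℝ v q e := by
  have h := (hg (u q, v q)).hasFDerivAt.comp q ((hu q).hasFDerivAt.prodMk (hv q).hasFDerivAt)
  have h' : fderiv ℝ (fun q => g (u q, v q)) q = _ := h.fderiv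
  rw [h', ← fderiv_apply_eq_pu_add_pv]
  rfl

lemma pv_pu_comm {W : ℝ × ℝ → ℝ} (hW : ContDiff ℝ 2 W) (p : ℝ × ℝ) :
    pv (pu W) p = pu (pv W) p := by
  have hd : DifferentiableAt ℝ (fderiv ℝ W) p :=
    (hW.fderiv_right (m := 1) (by norm_num)).differentiable (by norm_num) p
  have key (e f : ℝ × ℝ) :
      fderiv ℝ (fun x => fderiv ℝ W x e) p f = fderiv ℝ (fderiv ℝ W) p f e := by
    rw [fderiv_clm_apply hd (differentiableAt_const e)]
    simp
  have hs : IsSymmSndFDerivAt ℝ W p := hW.contDiffAt.isSymmSndFDerivAt (by simp)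
  change fderiv ℝ (fun x => fderiv ℝ W x (1, 0)) p (0, 1) =
    fderiv ℝ (fun x => fderiv ℝ W x (0, 1)) p (1, 0)
  rw [key, key]
  exact hs _ _

theorem stmt12 (W : ℝ × ℝ → ℝ) (hW : ContDiff ℝ 3 W)
    (hheat : ∀ p, pv W p = pu (pu W) p)
    (u v : ℝ × ℝ → ℝ) (hu : Differentiable ℝ u) (hv : Differentiable ℝ v)
    (h1 : ∀ q : ℝ × ℝ, pv W (u q, v q) = q.1)
    (h2 : ∀ q : ℝ × ℝ, pu W (u q, v q) - u q * pv W (u q, v q) = q.2)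
    (q₀ : ℝ × ℝ) (hW3 : pu (pu (pu W)) (u q₀, v q₀) ≠ 0) :
    pu u q₀ = u q₀ * pv u q₀ + pv v q₀ ∧ pu v q₀ = u q₀ * pv v q₀ := by
  have hW2 : ContDiff ℝ 2 W := hW.of_le (by norm_num)
  have hfd : Differentiable ℝ (fderiv ℝ W) :=
    (hW2.fderiv_right (m := 1) (by norm_num)).differentiable (by norm_num)
  have hdu : Differentiable ℝ (pu W) := hfd.clm_apply (differentiable_const _)
  have hdv : Differentiable ℝ (pv W) := hfd.clm_apply (differentiable_const _)
  have hvu : pu (pv W) (u q₀, v q₀) = pu (pu (pu W)) (u q₀, v q₀) := by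
    rw [show pv W = pu (pu W) from funext hheat]
  have huv := (pv_pu_comm hW2 (u q₀, v q₀)).trans hvu
  have huu : pu (pu W) (u q₀, v q₀) = q₀.1 := (hheat _).symm.trans (h1 q₀)
  have d1 (e : ℝ × ℝ) := fderiv_comp_prodMk_apply hdv hu hv q₀ e
  have d2 (e : ℝ × ℝ) := fderiv_comp_prodMk_apply hdu hu hv q₀ e
  have e1 : (fun q => pv W (u q, v q)) = fun q => q.1 := funext h1
  have e2 : (fun q => pu W (u q, v q)) = fun q => q.2 + u q * q.1 := by
    funext q
    linear_combination h2 q + u q * h1 q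
  have r1 (e : ℝ × ℝ) : fderiv ℝ (fun q : ℝ × ℝ => q.1) q₀ e = e.1 := by
    rw [hasFDerivAt_fst.fderiv]
    rfl
  have r2 (e : ℝ × ℝ) : fderiv ℝ (fun q : ℝ × ℝ => q.2 + u q * q.1) q₀ e =
      e.2 + (u q₀ * e.1 + q₀.1 * fderiv ℝ u q₀ e) := by
    have h := (hasFDerivAt_snd (𝕜 := ℝ) (p := q₀)).add
      ((hu q₀).hasFDerivAt.mul (hasFDerivAt_fst (𝕜 := ℝ) (p := q₀)))
    have h' : fderiv ℝ (fun q : ℝ × ℝ => q.2 + u q * q.1) q₀ = _ := h.fderiv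
    rw [h']
    simp
  simp only [e1, r1, hvu] at d1
  simp only [e2, r2, huv, huu] at d2
  have d1t := d1 (1, 0)
  have d1x := d1 (0, 1)
  have d2t := d2 (1, 0)
  have d2x := d2 (0, 1)
  change _ = _ * pu u q₀ + _ * pu v q₀ at d1t
  change _ = _ * pv u q₀ + _ * pv v q₀ at d1x
  change _ + (_ + _ * pu u q₀) = _ * pu u q₀ + _ * pu v q₀ at d2t
  change _ + (_ + _ * pv u q₀) = _ * pv u q₀ + _ * pv v q₀ at d2x
  simp only at d1t d1x d2t d2x
  have hvt : pu v q₀ = u q₀ * pv v q₀ := by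
    apply mul_left_cancel₀ hW3
    linear_combination u q₀ * d2x - d2t
  refine ⟨?_, hvt⟩
  apply mul_left_cancel₀ hW3
  linear_combination u q₀ * d1x - d1t + d2x - pv (pv W) (u q₀, v q₀) * hvt
end

section
/- Let N ≥ 3 and let W: ℝ^N → ℝ be a smooth function satisfying ∂W/∂u_m = ∂^m W/∂u_1^m for all m = 2, …, N. Define t = ∂W/∂u_2 and x = ∂W/∂u_1 − u_1 ∂W/∂u_2. Then at every point p where ∂^l W/∂u_1^l (p) = 0 for all l = 3, …, N, the 2×2 determinant of partial derivatives with respect to the last two coordinates equals the square of the (N+1)-st u_1-derivative: (∂t/∂u_{N−1} · ∂x/∂u_N − ∂t/∂u_N · ∂x/∂u_{N−1})(p) = (∂^{N+1} W/∂u_1^{N+1}(p))². In particular, the mapping of the surface S^(N) into the (t,x)-plane is regular (has rank 2) wherever ∂^{N+1} W/∂u_1^{N+1} ≠ 0. -/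
/-- Partial derivative of `f : ℝ^N → ℝ` in the `j`-th coordinate direction. -/
noncomputable def pdN {N : ℕ} (j : Fin N) (f : (Fin N → ℝ) → ℝ) (p : Fin N → ℝ) : ℝ :=
  fderiv ℝ f p (Pi.single j 1)

/-- `m`-th iterated partial derivative with respect to the first coordinate `u_1`. -/
noncomputable def du1iter {N : ℕ} (h : 0 < N) : ℕ → ((Fin N → ℝ) → ℝ) → ((Fin N → ℝ) → ℝ)
  | 0, f => f
  | m + 1, f => pdN ⟨0, h⟩ (du1iter h m f)

theorem contDiff_pdN {N : ℕ} {f : (Fin N → ℝ) → ℝ} (hf : ContDiff ℝ (⊤ : ℕ∞) f) (j : Fin N) :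
    ContDiff ℝ (⊤ : ℕ∞) (pdN j f) :=
  (hf.fderiv_right (by simp)).clm_apply contDiff_const

theorem contDiff_du1iter {N : ℕ} (h : 0 < N) {f : (Fin N → ℝ) → ℝ}
    (hf : ContDiff ℝ (⊤ : ℕ∞) f) (m : ℕ) : ContDiff ℝ (⊤ : ℕ∞) (du1iter h m f) := by
  induction m with
  | zero => exact hf
  | succ m ih => exact contDiff_pdN ih _

theorem pdN_comm {N : ℕ} {f : (Fin N → ℝ) → ℝ} (hf : ContDiff ℝ (⊤ : ℕ∞) f) (i j : Fin N) :
    pdN i (pdN j f) = pdN j (pdN i f) := by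
  have hd : Differentiable ℝ (fderiv ℝ f) :=
    (hf.fderiv_right (m := (⊤ : ℕ∞)) (by simp)).differentiable (by simp)
  have key (k l : Fin N) (p : Fin N → ℝ) :
      pdN k (pdN l f) p = fderiv ℝ (fderiv ℝ f) p (Pi.single k 1) (Pi.single l 1) := by
    change fderiv ℝ (fun q => fderiv ℝ f q (Pi.single l 1)) p (Pi.single k 1) = _
    rw [fderiv_clm_apply (hd p) (differentiableAt_const _)]
    simp
  funext p
  rw [key, key]
  have h2 : minSmoothness ℝ 2 ≤ ((⊤ : ℕ∞) : WithTop ℕ∞) := by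
    simpa using WithTop.coe_le_coe.2 (le_top : (2 : ℕ∞) ≤ ⊤)
  exact (hf.contDiffAt.isSymmSndFDerivAt h2).eq _ _

theorem pdN_du1iter_comm {N : ℕ} (h : 0 < N) {f : (Fin N → ℝ) → ℝ}
    (hf : ContDiff ℝ (⊤ : ℕ∞) f) (i : Fin N) (m : ℕ) :
    pdN i (du1iter h m f) = du1iter h m (pdN i f) := by
  induction m with
  | zero => rfl
  | succ m ih =>
    change pdN i (pdN _ (du1iter h m f)) = pdN _ (du1iter h m (pdN i f))
    rw [pdN_comm (contDiff_du1iter h hf m), ih]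

theorem du1iter_du1iter {N : ℕ} (h : 0 < N) (f : (Fin N → ℝ) → ℝ) (m k : ℕ) :
    du1iter h m (du1iter h k f) = du1iter h (m + k) f := by
  induction m with
  | zero => rw [Nat.zero_add]; rfl
  | succ m ih =>
    rw [Nat.succ_add]
    exact congrArg (pdN _) ih

theorem pdN_sub_coord_mul {N : ℕ} {f g : (Fin N → ℝ) → ℝ} {p : Fin N → ℝ}
    (hf : DifferentiableAt ℝ f p) (hg : DifferentiableAt ℝ g p) {i j : Fin N} (hij : i ≠ j) :
    pdN i (fun q => f q - q j * g q) p = pdN i f p - p j * pdN i g p := by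
  have hc : HasFDerivAt (fun q : Fin N → ℝ => q j) (ContinuousLinearMap.proj j) p :=
    hasFDerivAt_apply (𝕜 := ℝ) (F' := fun _ : Fin N => ℝ) j p
  have hd := hf.hasFDerivAt.sub (hc.mul hg.hasFDerivAt)
  have he := congrArg (fun L => L (Pi.single i 1)) hd.fderiv
  refine Eq.trans he ?_
  simp [pdN, Pi.single_eq_of_ne hij.symm]

theorem stmt15 (N : ℕ) (hN : 3 ≤ N) (W : (Fin N → ℝ) → ℝ) (hW : ContDiff ℝ (⊤ : ℕ∞) W)
    (hsys : ∀ i : Fin N, 1 ≤ (i : ℕ) →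
      ∀ p, pdN i W p = du1iter (by omega) ((i : ℕ) + 1) W p)
    (t x : (Fin N → ℝ) → ℝ)
    (ht : ∀ p, t p = pdN (⟨1, by omega⟩ : Fin N) W p)
    (hx : ∀ p, x p = pdN (⟨0, by omega⟩ : Fin N) W p
      - p ⟨0, by omega⟩ * pdN (⟨1, by omega⟩ : Fin N) W p)
    (p : Fin N → ℝ)
    (hp : ∀ l : ℕ, 3 ≤ l → l ≤ N → du1iter (by omega : 0 < N) l W p = 0) :
    pdN (⟨N - 2, by omega⟩ : Fin N) t p * pdN (⟨N - 1, by omega⟩ : Fin N) x p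
      - pdN (⟨N - 1, by omega⟩ : Fin N) t p * pdN (⟨N - 2, by omega⟩ : Fin N) x p
      = (du1iter (by omega : 0 < N) (N + 1) W p) ^ 2 := by
  have h0 : 0 < N := by omega
  have hpd (i : Fin N) (hi : 1 ≤ (i : ℕ)) (m : ℕ) :
      pdN i (du1iter h0 m W) p = du1iter h0 (m + (i + 1)) W p := by
    rw [pdN_du1iter_comm h0 hW, show pdN i W = du1iter h0 (i + 1) W from funext (hsys i hi),
      du1iter_du1iter]
  have hdiff (m : ℕ) : DifferentiableAt ℝ (du1iter h0 m W) p :=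
    (contDiff_du1iter h0 hW m).differentiable (by simp) p
  have htW : t = du1iter h0 2 W := funext fun q => (ht q).trans (hsys ⟨1, by omega⟩ le_rfl q)
  have hxW : x = fun q => du1iter h0 1 W q - q ⟨0, h0⟩ * du1iter h0 2 W q := by
    funext q
    rw [hx, ← ht, htW]
    rfl
  have hpt (i : Fin N) (hi : 1 ≤ (i : ℕ)) : pdN i t p = du1iter h0 (i + 3) W p := by
    rw [htW, hpd i hi, show 2 + ((i : ℕ) + 1) = i + 3 by omega]
  have hpx (i : Fin N) (hi : 1 ≤ (i : ℕ)) :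
      pdN i x p = du1iter h0 (i + 2) W p - p ⟨0, h0⟩ * du1iter h0 (i + 3) W p := by
    have hne : i ≠ ⟨0, h0⟩ := by
      rintro rfl
      simp at hi
    rw [hxW, pdN_sub_coord_mul (hdiff 1) (hdiff 2) hne, hpd i hi, hpd i hi,
      show 1 + ((i : ℕ) + 1) = i + 2 by omega, show 2 + ((i : ℕ) + 1) = i + 3 by omega]
  obtain ⟨n, rfl⟩ : ∃ n, N = n + 3 := ⟨N - 3, by omega⟩
  rw [hpt _ (by simp), hpt _ (by simp), hpx _ (by simp), hpx _ (by simp)]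
  have hN0 : du1iter h0 (n + 3) W p = 0 := hp _ (by omega) le_rfl
  simp only [show n + 3 - 2 + 3 = n + 4 by omega, show n + 3 - 1 + 2 = n + 4 by omega,
    show n + 3 - 1 + 3 = n + 5 by omega, show n + 3 - 2 + 2 = n + 3 by omega, hN0]
  ring
end
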